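/- arXiv:1311.6607 — 2 statements merged into one kernel-verified Lean document; each statement's English description precedes it below -/
import Mathlib

section
/- For every α ∈ (0,1) and every τ ∈ (−1,0), the function s ↦ c(α,s) has a first derivative at τ given by c'(α,τ) = ∫₀^∞ (|1−t|^τ log|1−t| + (1+t)^τ log(1+t))/t^{1+2α} dt, where the integrand is Lebesgue integrable on (0,∞). -/
open MeasureTheory Real Set

noncomputable def c (α τ : ℝ) : ℝ :=
  ∫ t in Set.Ioi (0:ℝ), (|1 - t| ^ τ + (1 + t) ^ τ - 2) / t ^ (1 + 2 * α)

/-- A symmetric second difference is controlled by a bound on the second derivative. -/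
lemma abs_symm_second_difference_le {h h' h'' : ℝ → ℝ} {x r M t : ℝ}
    (hh : ∀ u ∈ Icc (x - r) (x + r), HasDerivAt h (h' u) u)
    (hh' : ∀ u ∈ Icc (x - r) (x + r), HasDerivAt h' (h'' u) u)
    (hM : ∀ u ∈ Icc (x - r) (x + r), |h'' u| ≤ M) (ht : t ∈ Icc 0 r) :
    |h (x - t) + h (x + t) - 2 * h x| ≤ 2 * M * t ^ 2 := by
  have mem_add : ∀ v ∈ Icc 0 t, x + v ∈ Icc (x - r) (x + r) := fun v hv =>
    ⟨by linarith [hv.1, hv.2, ht.1, ht.2], by linarith [hv.1, hv.2, ht.1, ht.2]⟩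
  have mem_sub : ∀ v ∈ Icc 0 t, x - v ∈ Icc (x - r) (x + r) := fun v hv =>
    ⟨by linarith [hv.1, hv.2, ht.1, ht.2], by linarith [hv.1, hv.2, ht.1, ht.2]⟩
  have hM0 : 0 ≤ M := (abs_nonneg _).trans (hM _ (mem_add t ⟨ht.1, le_rfl⟩))
  have h1 : ∀ v ∈ Icc 0 t, |h' (x + v) - h' (x - v)| ≤ 2 * M * t := by
    intro v hv
    have := (convex_Icc (x - r) (x + r)).norm_image_sub_le_of_norm_hasDerivWithin_le
      (fun u hu => (hh' u hu).hasDerivWithinAt) hM (mem_sub v hv) (mem_add v hv)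
    rw [norm_eq_abs, norm_eq_abs] at this
    have e : |x + v - (x - v)| = 2 * v := by
      rw [abs_of_nonneg] <;> linarith [hv.1]
    rw [e] at this
    nlinarith [hv.2]
  have h2 : ∀ v ∈ Icc 0 t, HasDerivWithinAt (fun v => h (x - v) + h (x + v))
      (h' (x + v) - h' (x - v)) (Icc 0 t) v := by
    intro v hv
    have a1 := HasDerivAt.comp_const_add x v (hh _ (mem_add v hv))
    have a2 := HasDerivAt.comp_const_sub x v (hh _ (mem_sub v hv))
    exact ((a2.add a1).congr_deriv (by ring)).hasDerivWithinAt
  have := (convex_Icc 0 t).norm_image_sub_le_of_norm_hasDerivWithin_le h2 h1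
    (left_mem_Icc.2 ht.1) (right_mem_Icc.2 ht.1)
  simp only [norm_eq_abs, sub_zero, add_zero, abs_of_nonneg ht.1] at this
  calc |h (x - t) + h (x + t) - 2 * h x| = |h (x - t) + h (x + t) - (h x + h x)| := by
        rw [two_mul]
    _ ≤ 2 * M * t * t := this
    _ = 2 * M * t ^ 2 := by ring

lemma rpow_sub_two_le_eight {s u : ℝ} (hs : s ∈ Icc (-1 : ℝ) 0) (hu : 1 / 2 ≤ u) :
    u ^ (s - 2) ≤ 8 := by
  calc u ^ (s - 2) ≤ (1 / 2 : ℝ) ^ (s - 2) :=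
        rpow_le_rpow_of_nonpos (by norm_num) hu (by linarith [hs.2])
    _ ≤ (1 / 2 : ℝ) ^ (-3 : ℝ) :=
        rpow_le_rpow_of_exponent_ge (by norm_num) (by norm_num) (by linarith [hs.1])
    _ = 8 := by
        rw [show (-3 : ℝ) = ((-3 : ℤ) : ℝ) by norm_num, rpow_intCast]; norm_num

lemma abs_rpow_symm_second_difference_le {s t : ℝ} (hs : s ∈ Icc (-1 : ℝ) 0)
    (ht : t ∈ Icc (0 : ℝ) (1 / 2)) :
    |(1 - t) ^ s + (1 + t) ^ s - 2| ≤ 32 * t ^ 2 := by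
  have pos : ∀ u ∈ Icc (1 - 1 / 2 : ℝ) (1 + 1 / 2), u ≠ 0 := fun u hu => by
    have := hu.1
    intro h
    norm_num [h] at this
  have := abs_symm_second_difference_le (h := fun u => u ^ s) (h' := fun u => s * u ^ (s - 1))
    (h'' := fun u => s * ((s - 1) * u ^ (s - 2))) (x := 1) (r := 1 / 2) (M := 16) (t := t)
    (fun u hu => hasDerivAt_rpow_const (Or.inl (pos u hu)))
    (fun u hu => by
      have := (hasDerivAt_rpow_const (p := s - 1) (Or.inl (pos u hu))).const_mul s
      rwa [show s - 1 - 1 = s - 2 by ring] at this)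
    (fun u hu => by
      have hu1 : 1 / 2 ≤ u := by linarith [hu.1]
      have h8 := rpow_sub_two_le_eight hs hu1
      have h0 : 0 ≤ u ^ (s - 2) := rpow_nonneg (by linarith) _
      have hc : 0 ≤ s * (s - 1) ∧ s * (s - 1) ≤ 2 :=
        ⟨by nlinarith [hs.1, hs.2], by nlinarith [hs.1, hs.2]⟩
      rw [← mul_assoc, abs_of_nonneg (mul_nonneg hc.1 h0)]
      nlinarith)
    ht
  simp only [one_rpow, mul_one] at this
  linarith

lemma abs_rpow_mul_log_symm_second_difference_le {s t : ℝ} (hs : s ∈ Icc (-1 : ℝ) 0)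
    (ht : t ∈ Icc (0 : ℝ) (1 / 2)) :
    |(1 - t) ^ s * log (1 - t) + (1 + t) ^ s * log (1 + t)| ≤ 80 * t ^ 2 := by
  have pos : ∀ u ∈ Icc (1 - 1 / 2 : ℝ) (1 + 1 / 2), 0 < u := fun u hu => by
    linarith [hu.1]
  have := abs_symm_second_difference_le (h := fun u => u ^ s * log u)
    (h' := fun u => s * (u ^ (s - 1) * log u) + u ^ (s - 1))
    (h'' := fun u => s * (s - 1) * (u ^ (s - 2) * log u) + (2 * s - 1) * u ^ (s - 2))
    (x := 1) (r := 1 / 2) (M := 40) (t := t)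
    (fun u hu => by
      have hp := pos u hu
      refine ((hasDerivAt_rpow_const (p := s) (Or.inl hp.ne')).mul
        (hasDerivAt_log hp.ne')).congr_deriv ?_
      rw [rpow_sub_one hp.ne']
      field_simp)
    (fun u hu => by
      have hp := pos u hu
      have h1 := hasDerivAt_rpow_const (p := s - 1) (Or.inl hp.ne')
      refine (((h1.mul (hasDerivAt_log hp.ne')).const_mul s).add h1).congr_deriv ?_
      rw [show s - 1 - 1 = s - 2 by ring, show s - 1 = s - 2 + 1 by ring, rpow_add_one hp.ne']
      field_simp
      ring)
    (fun u hu => by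
      have hp := pos u hu
      have hu1 : 1 / 2 ≤ u := by linarith [hu.1]
      have h8 := rpow_sub_two_le_eight hs hu1
      have h0 : 0 ≤ u ^ (s - 2) := rpow_nonneg hp.le _
      have hlog : |log u| ≤ 1 := by
        rw [abs_le]
        constructor
        · have h3 := one_sub_inv_le_log_of_pos hp
          have : u⁻¹ ≤ 2 := by
            rw [inv_le_comm₀ hp (by norm_num)]
            linarith
          linarith
        · linarith [log_le_sub_one_of_pos hp, hu.2]
      have hc : |s * (s - 1)| ≤ 2 := by
        rw [abs_le]
        constructor <;> nlinarith [hs.1, hs.2]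
      have hd : |2 * s - 1| ≤ 3 := by
        rw [abs_le]
        constructor <;> linarith [hs.1, hs.2]
      calc _ ≤ |s * (s - 1) * (u ^ (s - 2) * log u)| + |(2 * s - 1) * u ^ (s - 2)| :=
            abs_add_le _ _
        _ = |s * (s - 1)| * (u ^ (s - 2) * |log u|) + |2 * s - 1| * u ^ (s - 2) := by
            rw [abs_mul, abs_mul (u ^ (s - 2)), abs_mul (2 * s - 1), abs_of_nonneg h0]
        _ ≤ 2 * (8 * 1) + 3 * 8 := by gcongr
        _ = 40 := by norm_num)
    ht
  simp only [log_one, mul_zero, sub_zero] at this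
  linarith

lemma intervalIntegrable_abs_rpow {b : ℝ} (hb : -1 < b) (x y : ℝ) :
    IntervalIntegrable (fun t : ℝ => |t| ^ b) volume x y := by
  have key : ∀ y : ℝ, 0 ≤ y → IntervalIntegrable (fun t : ℝ => |t| ^ b) volume 0 y := by
    intro y hy
    refine (intervalIntegral.intervalIntegrable_rpow' hb).congr ?_
    intro t ht
    rw [uIoc_of_le hy] at ht
    simp only [abs_of_pos ht.1]
  have zero_to : ∀ y : ℝ, IntervalIntegrable (fun t : ℝ => |t| ^ b) volume 0 y := by
    intro y
    rcases le_total 0 y with hy | hy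
    · exact key y hy
    · rw [IntervalIntegrable.iff_comp_neg]
      simpa using key (-y) (by linarith)
  exact (zero_to x).symm.trans (zero_to y)

/-- The function dominating the integrand of `c` and its derivative in the exponent. -/
noncomputable def dominating (α b δ t : ℝ) : ℝ :=
  (Ioc (0 : ℝ) (1 / 2)).indicator (fun t => t ^ (1 - 2 * α)) t +
  (Ioc (1 / 2 : ℝ) 2).indicator (fun t => |1 - t| ^ b + 1) t +
  (Ioi (2 : ℝ)).indicator (fun t => t ^ (δ - 1 - 2 * α)) t

lemma integrable_dominating {α b δ : ℝ} (hα : α < 1) (hb : -1 < b) (hδ : δ < 2 * α) :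
    Integrable (dominating α b δ) := by
  refine Integrable.add (Integrable.add ?_ ?_) ?_
  · rw [integrable_indicator_iff measurableSet_Ioc,
      ← intervalIntegrable_iff_integrableOn_Ioc_of_le (by norm_num)]
    exact intervalIntegral.intervalIntegrable_rpow' (by linarith)
  · rw [integrable_indicator_iff measurableSet_Ioc,
      ← intervalIntegrable_iff_integrableOn_Ioc_of_le (by norm_num)]
    have := (intervalIntegrable_abs_rpow hb (1 - 1 / 2) (1 - 2)).comp_sub_left 1
    simp only [sub_sub_cancel] at this
    exact this.add intervalIntegrable_const
  · rw [integrable_indicator_iff measurableSet_Ioi]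
    exact integrableOn_Ioi_rpow_of_lt (by linarith) (by norm_num)

lemma abs_div_rpow_le_dominating {α b δ C t N : ℝ} (hα : α ∈ Ioo (0 : ℝ) 1) (ht : 0 < t)
    (hC : 0 ≤ C)
    (small : t ≤ 1 / 2 → |N| ≤ C * t ^ 2)
    (middle : 1 / 2 < t → t ≤ 2 → |N| ≤ C * (|1 - t| ^ b + 1))
    (large : 2 < t → |N| ≤ C * t ^ δ) :
    |N / t ^ (1 + 2 * α)| ≤ 8 * C * dominating α b δ t := by
  have hp : 0 < t ^ (1 + 2 * α) := rpow_pos_of_pos ht _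
  rw [abs_div, abs_of_pos hp, div_le_iff₀ hp]
  rcases le_or_gt t (1 / 2) with h1 | h1
  · have hd : dominating α b δ t = t ^ (1 - 2 * α) := by
      have h1' : t ≤ (2 : ℝ)⁻¹ := by norm_num at h1 ⊢; linarith
      simp [dominating, indicator, ht, h1', not_lt.2 h1', show ¬ (2 < t) by linarith]
    rw [hd, mul_assoc, ← rpow_add ht, show 1 - 2 * α + (1 + 2 * α) = (2 : ℕ) by norm_num,
      rpow_natCast]
    nlinarith [small h1, mul_nonneg hC (sq_nonneg t)]
  rcases le_or_gt t 2 with h2 | h2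
  · have hd : dominating α b δ t = |1 - t| ^ b + 1 := by
      have h1' : (2 : ℝ)⁻¹ < t := by norm_num at h1 ⊢; linarith
      simp [dominating, indicator, ht, h1', not_le.2 h1', h2, not_lt.2 h2]
    have h8 : 1 ≤ 8 * t ^ (1 + 2 * α) := by
      rcases le_total t 1 with h3 | h3
      · have : t ^ (3 : ℕ) ≤ t ^ (1 + 2 * α) := by
          rw [← rpow_natCast]
          exact rpow_le_rpow_of_exponent_ge ht h3 (by push_cast; linarith [hα.2])
        have h4 : (1 / 2 : ℝ) ^ 3 ≤ t ^ 3 := by gcongr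
        norm_num at h4
        linarith
      · linarith [one_le_rpow h3 (show 0 ≤ 1 + 2 * α by linarith [hα.1])]
    have hm := middle h1 h2
    rw [hd]
    have h0 : 0 ≤ C * (|1 - t| ^ b + 1) := (abs_nonneg _).trans hm
    nlinarith [mul_le_mul_of_nonneg_left h8 h0]
  · have hd : dominating α b δ t = t ^ (δ - 1 - 2 * α) := by
      have h1' : (2 : ℝ)⁻¹ < t := by norm_num at h1 ⊢; linarith
      simp [dominating, indicator, h1', not_le.2 h1', h2, not_le.2 h2]
    rw [hd, mul_assoc, ← rpow_add ht, show δ - 1 - 2 * α + (1 + 2 * α) = δ by ring]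
    nlinarith [large h2, mul_nonneg hC (rpow_nonneg ht.le δ)]

lemma log_one_add_nonneg_and_rpow_le_one {s t : ℝ} (hs : s ≤ 0) (ht : 0 ≤ t) :
    0 ≤ log (1 + t) ∧ 0 ≤ (1 + t) ^ s ∧ (1 + t) ^ s ≤ 1 :=
  ⟨log_nonneg (by linarith), rpow_nonneg (by linarith) _,
    rpow_le_one_of_one_le_of_nonpos (by linarith) hs⟩

lemma abs_rpow_mul_log_le {a δ s x : ℝ} (hδ : 0 < δ) (has : a ≤ s) (hx : 0 < x) (hx1 : x ≤ 1) :
    |x ^ s * log x| ≤ 1 / δ * x ^ (a - δ) := by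
  have h1 := (abs_log_mul_self_rpow_lt x δ hx hx1 hδ).le
  have e : x ^ s * log x = x ^ (s - δ) * (log x * x ^ δ) := by
    rw [mul_comm (log x), ← mul_assoc, ← rpow_add hx, sub_add_cancel]
  rw [e, abs_mul, abs_of_nonneg (rpow_nonneg hx.le _), mul_comm]
  have h2 : x ^ (s - δ) ≤ x ^ (a - δ) :=
    rpow_le_rpow_of_exponent_ge hx hx1 (by linarith)
  gcongr

lemma abs_integrand_le_dominating {α a δ s t : ℝ} (hα : α ∈ Ioo (0 : ℝ) 1) (ha : -1 < a)
    (hδ : 0 < δ) (hs : s ∈ Ioo a 0) (ht : 0 < t) (ht1 : t ≠ 1) :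
    |(|1 - t| ^ s + (1 + t) ^ s - 2) / t ^ (1 + 2 * α)| ≤
      8 * 32 * dominating α (a - δ) δ t := by
  obtain ⟨-, hq0, hq1⟩ := log_one_add_nonneg_and_rpow_le_one hs.2.le ht.le
  have hx : 0 < |1 - t| := abs_pos.2 (sub_ne_zero.2 ht1.symm)
  have hx0 : 0 ≤ |1 - t| ^ s := rpow_nonneg hx.le _
  refine abs_div_rpow_le_dominating hα ht (by norm_num) ?_ ?_ ?_
  · intro h
    rw [abs_of_nonneg (by linarith : 0 ≤ 1 - t)]
    exact abs_rpow_symm_second_difference_le ⟨by linarith [hs.1], hs.2.le⟩ ⟨ht.le, h⟩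
  · intro h1 h2
    have h3 : |1 - t| ^ s ≤ |1 - t| ^ (a - δ) :=
      rpow_le_rpow_of_exponent_ge hx (abs_le.2 ⟨by linarith, by linarith⟩) (by linarith [hs.1])
    rw [abs_le]
    constructor <;> linarith
  · intro h
    have h3 : |1 - t| ^ s ≤ 1 := by
      refine rpow_le_one_of_one_le_of_nonpos ?_ hs.2.le
      rw [abs_sub_comm, abs_of_nonneg] <;> linarith
    have h4 : 1 ≤ t ^ δ := one_le_rpow (by linarith) hδ.le
    rw [abs_le]
    constructor <;> linarith

lemma abs_deriv_integrand_le_dominating {α a δ s t : ℝ} (hα : α ∈ Ioo (0 : ℝ) 1) (ha : -1 < a)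
    (hδ : 0 < δ) (hs : s ∈ Ioo a 0) (ht : 0 < t) (ht1 : t ≠ 1) :
    |(|1 - t| ^ s * log |1 - t| + (1 + t) ^ s * log (1 + t)) / t ^ (1 + 2 * α)| ≤
      8 * (80 + 3 / δ) * dominating α (a - δ) δ t := by
  obtain ⟨hl0, hq0, hq1⟩ := log_one_add_nonneg_and_rpow_le_one hs.2.le ht.le
  have hx : 0 < |1 - t| := abs_pos.2 (sub_ne_zero.2 ht1.symm)
  have hd : 0 < 1 / δ := by positivity
  have hd3 : 3 / δ = 3 * (1 / δ) := by ring
  have hq : |(1 + t) ^ s * log (1 + t)| ≤ log (1 + t) := by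
    rw [abs_of_nonneg (mul_nonneg hq0 hl0)]
    exact mul_le_of_le_one_left hl0 hq1
  refine abs_div_rpow_le_dominating hα ht (by positivity) ?_ ?_ ?_
  · intro h
    rw [abs_of_nonneg (by linarith : 0 ≤ 1 - t)]
    refine (abs_rpow_mul_log_symm_second_difference_le
      ⟨by linarith [hs.1], hs.2.le⟩ ⟨ht.le, h⟩).trans ?_
    gcongr
    linarith
  · intro h1 h2
    have h3 := abs_rpow_mul_log_le hδ hs.1.le hx (abs_le.2 ⟨by linarith, by linarith⟩)
    have h4 := log_le_sub_one_of_pos (show 0 < 1 + t by linarith)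
    have h5 : 0 ≤ |1 - t| ^ (a - δ) := rpow_nonneg hx.le _
    refine (abs_add_le _ _).trans ?_
    nlinarith [mul_nonneg hd.le h5]
  · intro h
    have e : |1 - t| = t - 1 := by
      rw [abs_sub_comm, abs_of_nonneg]
      linarith
    rw [e]
    have hlog := log_le_rpow_div ht.le hδ
    have h0 : 0 ≤ log (t - 1) := log_nonneg (by linarith)
    have h1 : |(t - 1) ^ s * log (t - 1)| ≤ log (t - 1) := by
      rw [abs_of_nonneg (mul_nonneg (rpow_nonneg (by linarith) _) h0)]
      exact mul_le_of_le_one_left h0 (rpow_le_one_of_one_le_of_nonpos (by linarith) hs.2.le)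
    have h2 : log (t - 1) ≤ log t := log_le_log (by linarith) (by linarith)
    have h3 : log (1 + t) ≤ 2 * log t := by
      have : log (1 + t) ≤ log (t ^ 2) := log_le_log (by linarith) (by nlinarith)
      rwa [log_pow, Nat.cast_ofNat] at this
    have h4 : 0 ≤ t ^ δ := rpow_nonneg ht.le _
    have h5 : t ^ δ / δ = 1 / δ * t ^ δ := by ring
    refine (abs_add_le _ _).trans ?_
    nlinarith

theorem hasDerivAt_c (α τ : ℝ) (hα : α ∈ Set.Ioo (0:ℝ) 1)
    (hτ : τ ∈ Set.Ioo (-1:ℝ) 0) :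
    MeasureTheory.IntegrableOn
      (fun t : ℝ =>
        (|1 - t| ^ τ * Real.log |1 - t| + (1 + t) ^ τ * Real.log (1 + t)) / t ^ (1 + 2 * α))
      (Set.Ioi (0:ℝ)) ∧
    HasDerivAt (fun s => c α s)
      (∫ t in Set.Ioi (0:ℝ),
        (|1 - t| ^ τ * Real.log |1 - t| + (1 + t) ^ τ * Real.log (1 + t)) / t ^ (1 + 2 * α))
      τ := by
  obtain ⟨a, ha, haτ⟩ := exists_between hτ.1
  obtain ⟨δ, hδ, hδ'⟩ := exists_between
    (show 0 < min (2 * α) (1 + a) from lt_min (by linarith [hα.1]) (by linarith))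
  have hδα := hδ'.trans_le (min_le_left _ _)
  have hδa := hδ'.trans_le (min_le_right _ _)
  have hint := (integrable_dominating hα.2 (show -1 < a - δ by linarith) hδα).integrableOn
    (s := Ioi (0 : ℝ))
  have hae : ∀ᵐ t ∂(volume.restrict (Ioi (0 : ℝ))), 0 < t ∧ t ≠ 1 := by
    filter_upwards [ae_restrict_mem measurableSet_Ioi,
      ae_restrict_of_ae (Measure.ae_ne volume (1 : ℝ))] with t h1 h2 using ⟨h1, h2⟩
  have hmeas : ∀ s : ℝ, Measurable
      fun t : ℝ => (|1 - t| ^ s + (1 + t) ^ s - 2) / t ^ (1 + 2 * α) := fun s => by fun_prop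
  refine hasDerivAt_integral_of_dominated_loc_of_deriv_le
    (F := fun s t => (|1 - t| ^ s + (1 + t) ^ s - 2) / t ^ (1 + 2 * α))
    (F' := fun s t =>
      (|1 - t| ^ s * Real.log |1 - t| + (1 + t) ^ s * Real.log (1 + t)) / t ^ (1 + 2 * α))
    (Ioo_mem_nhds haτ hτ.2) (Filter.Eventually.of_forall fun s => (hmeas s).aestronglyMeasurable)
    ((hint.const_mul (8 * 32)).mono' (hmeas τ).aestronglyMeasurable ?_)
    (Measurable.aestronglyMeasurable (by fun_prop)) ?_
    (hint.const_mul (8 * (80 + 3 / δ))) ?_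
  · filter_upwards [hae] with t ht
      using abs_integrand_le_dominating hα ha hδ ⟨haτ, hτ.2⟩ ht.1 ht.2
  · filter_upwards [hae] with t ht s hs
      using abs_deriv_integrand_le_dominating hα ha hδ hs ht.1 ht.2
  · filter_upwards [hae] with t ht s _
    have h1 := (hasStrictDerivAt_const_rpow
      (abs_pos.2 (sub_ne_zero.2 ht.2.symm)) s).hasDerivAt
    have h2 := (hasStrictDerivAt_const_rpow (show 0 < 1 + t by linarith [ht.1]) s).hasDerivAt
    exact ((h1.add h2).sub_const 2).div_const _
end

section
/- For every α ∈ (0,1) and every τ ∈ (−1,0), the function s ↦ c(α,s) has a second derivative at τ equal to c''(α,τ) = ∫₀^∞ (|1−t|^τ (log|1−t|)² + (1+t)^τ (log(1+t))²)/t^{1+2α} dt, and this second derivative is strictly positive; consequently τ ↦ c(α,τ) is strictly convex on the interval (−1,0]. -/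
open MeasureTheory Real Set

noncomputable section

/-- The integrand defining `c`. -/
def cIntegrand (α s t : ℝ) : ℝ :=
  (|1 - t| ^ s + (1 + t) ^ s - 2) / t ^ (1 + 2 * α)

/-- The derivative of `cIntegrand` in the exponent. -/
def cIntegrandDeriv (α s t : ℝ) : ℝ :=
  (|1 - t| ^ s * log |1 - t| + (1 + t) ^ s * log (1 + t)) / t ^ (1 + 2 * α)

/-- The second derivative of `cIntegrand` in the exponent. -/
def cIntegrandDerivTwo (α s t : ℝ) : ℝ :=
  (|1 - t| ^ s * (log |1 - t|) ^ 2 + (1 + t) ^ s * (log (1 + t)) ^ 2) / t ^ (1 + 2 * α)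

end

lemma one_add_sq_div_two_le_cosh (y : ℝ) : 1 + y ^ 2 / 2 ≤ cosh y := by
  have h1 : (y / 2) ^ 2 ≤ sinh (y / 2) ^ 2 := by
    rcases le_total 0 (y / 2) with h | h
    · exact pow_le_pow_left₀ h (self_le_sinh_iff.2 h) 2
    · have := sinh_le_self_iff.2 h
      nlinarith
  have h2 := cosh_two_mul (y / 2)
  rw [cosh_sq, mul_div_cancel₀ y two_ne_zero] at h2
  linarith

section Rpow

variable {x : ℝ}

lemma mul_rpow_mul_log_le (hx : 0 < x) (s h : ℝ) :
    h * (x ^ s * log x) ≤ x ^ (s + h) - x ^ s := by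
  have h1 : log x * h + 1 ≤ x ^ h := by
    rw [rpow_def_of_pos hx]; exact add_one_le_exp _
  rw [rpow_add hx]
  nlinarith [mul_le_mul_of_nonneg_left h1 (rpow_pos_of_pos hx s).le]

lemma sq_mul_rpow_mul_log_sq_le (hx : 0 < x) (s h : ℝ) :
    h ^ 2 * (x ^ s * (log x) ^ 2) ≤ x ^ (s + h) + x ^ (s - h) - 2 * x ^ s := by
  have h1 : 2 + (log x * h) ^ 2 ≤ x ^ h + x ^ (-h) := by
    rw [rpow_def_of_pos hx, rpow_def_of_pos hx, mul_neg]
    have := one_add_sq_div_two_le_cosh (log x * h)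
    rw [Real.cosh_eq] at this
    linarith
  rw [sub_eq_add_neg s h, rpow_add hx, rpow_add hx]
  nlinarith [mul_le_mul_of_nonneg_left h1 (rpow_pos_of_pos hx s).le]

lemma monotone_rpow_mul_log (hx : 0 < x) : Monotone fun s : ℝ => x ^ s * log x := by
  intro a b hab
  rcases le_total 1 x with h | h
  · exact mul_le_mul_of_nonneg_right (rpow_le_rpow_of_exponent_le h hab) (log_nonneg h)
  · exact mul_le_mul_of_nonpos_right (rpow_le_rpow_of_exponent_ge hx h hab)
      (log_nonpos hx.le h)

lemma rpow_le_rpow_add_rpow (hx : 0 < x) {a s b : ℝ} (has : a ≤ s) (hsb : s ≤ b) :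
    x ^ s ≤ x ^ a + x ^ b := by
  have ha := rpow_pos_of_pos hx a
  have hb := rpow_pos_of_pos hx b
  rcases le_total 1 x with h | h
  · linarith [rpow_le_rpow_of_exponent_le h hsb]
  · linarith [rpow_le_rpow_of_exponent_ge hx h has]

lemma strictConvexOn_const_rpow (hx : 0 < x) (hx1 : x ≠ 1) :
    StrictConvexOn ℝ univ fun s : ℝ => x ^ s := by
  refine ⟨convex_univ, fun s _ r _ hsr a b ha hb hab => ?_⟩
  have hne : log x * s ≠ log x * r := fun h =>
    hsr (mul_left_cancel₀ (log_ne_zero_of_pos_of_ne_one hx hx1) h)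
  have := strictConvexOn_exp.2 (mem_univ _) (mem_univ _) hne ha hb hab
  simp only [smul_eq_mul, rpow_def_of_pos hx] at this ⊢
  convert this using 2
  ring

lemma convexOn_const_rpow (hx : 0 < x) : ConvexOn ℝ univ fun s : ℝ => x ^ s := by
  rcases eq_or_ne x 1 with rfl | h
  · simpa using convexOn_const (1 : ℝ) convex_univ
  · exact (strictConvexOn_const_rpow hx h).convexOn

lemma one_add_mul_log_le_rpow (hx : 0 < x) (s : ℝ) : 1 + s * log x ≤ x ^ s := by
  have := mul_rpow_mul_log_le hx 0 s
  simp only [rpow_zero, zero_add, one_mul] at this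
  linarith

lemma rpow_le_one_sub_mul (hx : 0 < x) {s : ℝ} (hs : s ∈ Ioc (-1 : ℝ) 0) :
    x ^ s ≤ 1 - s * (x⁻¹ - 1) := by
  have := (convexOn_const_rpow hx).2 (mem_univ (-1)) (mem_univ 0)
    (show 0 ≤ -s by linarith [hs.2]) (show 0 ≤ 1 + s by linarith [hs.1]) (by ring)
  simp only [smul_eq_mul, rpow_neg_one, rpow_zero] at this
  rw [show -s * -1 + (1 + s) * 0 = s by ring] at this
  linarith

end Rpow

lemma abs_one_sub_pos {t : ℝ} (ht : t ≠ 1) : 0 < |1 - t| :=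
  abs_pos.2 (sub_ne_zero.2 ht.symm)

lemma ae_restrict_Ioi_pos_and_ne_one :
    ∀ᵐ t ∂(volume.restrict (Ioi (0 : ℝ))), 0 < t ∧ t ≠ 1 := by
  filter_upwards [ae_restrict_mem measurableSet_Ioi,
    ae_restrict_of_ae (Measure.ae_ne volume (1 : ℝ))] with t h1 h2
  exact ⟨h1, h2⟩

lemma setIntegral_Ioi_pos {f : ℝ → ℝ} (hf : IntegrableOn f (Ioi 0))
    (hpos : ∀ t, 0 < t → t ≠ 1 → 0 < f t) : 0 < ∫ t in Ioi (0 : ℝ), f t := by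
  have hae : ∀ᵐ t ∂(volume.restrict (Ioi (0 : ℝ))), 0 < f t := by
    filter_upwards [ae_restrict_Ioi_pos_and_ne_one] with t ht using hpos t ht.1 ht.2
  rw [integral_pos_iff_support_of_nonneg_ae (hae.mono fun t h => h.le) hf]
  have : Function.support f =ᵐ[volume.restrict (Ioi (0 : ℝ))] univ :=
    Filter.eventuallyEq_univ.2 (hae.mono fun t h => h.ne')
  rw [measure_congr this]
  simp

section Measurability

variable (α s : ℝ)

lemma measurable_cIntegrand : Measurable (cIntegrand α s) := by
  unfold cIntegrand; fun_prop

lemma measurable_cIntegrandDeriv : Measurable (cIntegrandDeriv α s) := by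
  unfold cIntegrandDeriv; fun_prop

lemma measurable_cIntegrandDerivTwo : Measurable (cIntegrandDerivTwo α s) := by
  unfold cIntegrandDerivTwo; fun_prop

end Measurability

lemma integrableOn_abs_one_sub_rpow {s : ℝ} (hs : -1 < s) :
    IntegrableOn (fun t : ℝ => |1 - t| ^ s) (Ioc (1 / 2) 2) := by
  have key (a : ℝ) : IntervalIntegrable (fun t : ℝ => t ^ s) volume 0 a :=
    intervalIntegral.intervalIntegrable_rpow' hs
  have h1 : IntegrableOn (fun t : ℝ => |1 - t| ^ s) (Ioc (1 / 2) 1) := by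
    have := (key (1 / 2)).comp_sub_left 1
    have := (intervalIntegrable_iff_integrableOn_Ioc_of_le (by norm_num)).1 this.symm
    norm_num at this
    refine this.congr_fun (fun t ht => ?_) measurableSet_Ioc
    simp only [abs_of_nonneg (sub_nonneg.2 ht.2)]
  have h2 : IntegrableOn (fun t : ℝ => |1 - t| ^ s) (Ioc 1 2) := by
    have := (key 1).comp_sub_right 1
    have := (intervalIntegrable_iff_integrableOn_Ioc_of_le (by norm_num)).1 this
    norm_num at this
    refine this.congr_fun (fun t ht => ?_) measurableSet_Ioc
    simp only [abs_sub_comm 1 t, abs_of_nonneg (sub_nonneg.2 ht.1.le)]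
  rw [← Ioc_union_Ioc_eq_Ioc (b := 1) (by norm_num) (by norm_num)]
  exact h1.union h2

lemma abs_one_sub_rpow_add_one_add_rpow_sub_two_le {s t : ℝ} (hs : s ∈ Ioc (-1 : ℝ) 0)
    (ht : t ∈ Ioc (0 : ℝ) (1 / 2)) : |(1 - t) ^ s + (1 + t) ^ s - 2| ≤ 3 * t ^ 2 := by
  obtain ⟨h0, h1⟩ := ht
  have hm : 0 < 1 - t := by linarith
  have hp : 0 < 1 + t := by linarith
  have hlog : log (1 - t) + log (1 + t) ≤ 0 := by
    rw [← log_mul hm.ne' hp.ne']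
    exact log_nonpos (by positivity) (by nlinarith)
  have hinv : (1 - t)⁻¹ + (1 + t)⁻¹ - 2 ≤ 3 * t ^ 2 := by
    have : (1 - t)⁻¹ + (1 + t)⁻¹ = 2 / (1 - t ^ 2) := by
      have : 1 - t ^ 2 ≠ 0 := by nlinarith
      field_simp
      ring
    rw [this, sub_le_iff_le_add, div_le_iff₀ (by nlinarith)]
    nlinarith [mul_nonneg (sq_nonneg t) (show 0 ≤ 1 - 3 * t ^ 2 by nlinarith)]
  have hinv0 : 0 ≤ (1 - t)⁻¹ + (1 + t)⁻¹ - 2 := by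
    have h2 := add_one_le_exp (-log (1 - t))
    have h3 := add_one_le_exp (-log (1 + t))
    rw [exp_neg, exp_log hm] at h2
    rw [exp_neg, exp_log hp] at h3
    linarith
  rw [abs_of_nonneg]
  · have h2 := rpow_le_one_sub_mul hm hs
    have h3 := rpow_le_one_sub_mul hp hs
    nlinarith [hs.1, hs.2]
  · have h2 := one_add_mul_log_le_rpow hm s
    have h3 := one_add_mul_log_le_rpow hp s
    nlinarith [mul_nonneg_of_nonpos_of_nonpos hs.2 hlog]

lemma integrableOn_cIntegrand {α s : ℝ} (hα : α ∈ Ioo (0 : ℝ) 1) (hs : s ∈ Ioc (-1 : ℝ) 0) :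
    IntegrableOn (cIntegrand α s) (Ioi 0) := by
  have hmeas {μ : Measure ℝ} : AEStronglyMeasurable (cIntegrand α s) μ :=
    (measurable_cIntegrand α s).aestronglyMeasurable
  have hzero : IntegrableOn (cIntegrand α s) (Ioc 0 (1 / 2)) := by
    have hint : IntegrableOn (fun t : ℝ => 3 * t ^ (1 - 2 * α)) (Ioc 0 (1 / 2)) := by
      refine Integrable.const_mul ?_ 3
      exact (intervalIntegrable_iff_integrableOn_Ioc_of_le (by norm_num)).1
        (intervalIntegral.intervalIntegrable_rpow' (by linarith [hα.2]))
    refine Integrable.mono' hint hmeas ?_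
    filter_upwards [ae_restrict_mem measurableSet_Ioc] with t ht
    have hw := rpow_pos_of_pos ht.1 (1 + 2 * α)
    rw [cIntegrand, norm_div, norm_eq_abs, norm_of_nonneg hw.le, div_le_iff₀ hw, mul_assoc,
      ← rpow_add ht.1, abs_of_nonneg (by linarith [ht.2] : 0 ≤ 1 - t),
      show 1 - 2 * α + (1 + 2 * α) = (2 : ℕ) by push_cast; ring, rpow_natCast]
    exact abs_one_sub_rpow_add_one_add_rpow_sub_two_le hs ht
  have hmid : IntegrableOn (cIntegrand α s) (Ioc (1 / 2) 2) := by
    have hint : IntegrableOn (fun t : ℝ => (|1 - t| ^ s + 3) / (1 / 2) ^ (1 + 2 * α))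
        (Ioc (1 / 2) 2) :=
      ((integrableOn_abs_one_sub_rpow hs.1).add (integrable_const 3)).div_const _
    refine Integrable.mono' hint hmeas ?_
    filter_upwards [ae_restrict_mem measurableSet_Ioc] with t ht
    have ht0 : 0 < t := by linarith [ht.1]
    have hw := rpow_pos_of_pos ht0 (1 + 2 * α)
    rw [cIntegrand, norm_div, norm_eq_abs, norm_of_nonneg hw.le]
    have h1 : 0 ≤ |1 - t| ^ s := rpow_nonneg (abs_nonneg _) _
    have h2 : 0 ≤ (1 + t) ^ s := rpow_nonneg (by linarith) _
    have h3 : (1 + t) ^ s ≤ 1 := rpow_le_one_of_one_le_of_nonpos (by linarith) hs.2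
    refine div_le_div₀ (by positivity) ?_ (by positivity)
      (rpow_le_rpow (by norm_num) ht.1.le (by linarith [hα.1]))
    rw [abs_le]
    constructor <;> linarith
  have hinf : IntegrableOn (cIntegrand α s) (Ioi 2) := by
    have hint : IntegrableOn (fun t : ℝ => 2 * t ^ (-(1 + 2 * α))) (Ioi 2) :=
      (integrableOn_Ioi_rpow_of_lt (by linarith [hα.1]) (by norm_num)).const_mul 2
    refine Integrable.mono' hint hmeas ?_
    filter_upwards [ae_restrict_mem measurableSet_Ioi] with t ht
    have ht2 : 2 < t := ht
    have ht0 : 0 < t := by linarith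
    have hw := rpow_pos_of_pos ht0 (1 + 2 * α)
    rw [cIntegrand, norm_div, norm_eq_abs, norm_of_nonneg hw.le, rpow_neg ht0.le,
      ← div_eq_mul_inv]
    have h1 : 0 ≤ |1 - t| ^ s := rpow_nonneg (abs_nonneg _) _
    have h2 : 0 ≤ (1 + t) ^ s := rpow_nonneg (by linarith) _
    have h3 : (1 + t) ^ s ≤ 1 := rpow_le_one_of_one_le_of_nonpos (by linarith) hs.2
    have h4 : |1 - t| ^ s ≤ 1 := rpow_le_one_of_one_le_of_nonpos
      (by rw [abs_sub_comm, abs_of_nonneg] <;> linarith) hs.2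
    refine div_le_div_of_nonneg_right ?_ hw.le
    rw [abs_le]
    constructor <;> linarith
  have : Ioi (0 : ℝ) = Ioc 0 (1 / 2) ∪ Ioc (1 / 2) 2 ∪ Ioi 2 := by
    rw [Ioc_union_Ioc_eq_Ioc (by norm_num) (by norm_num), Ioc_union_Ioi_eq_Ioi (by norm_num)]
  rw [this]
  exact (hzero.union hmid).union hinf

section Pointwise

variable {t : ℝ} (α : ℝ)

lemma mul_cIntegrandDeriv_le (ht : 0 < t) (ht1 : t ≠ 1) (s h : ℝ) :
    h * cIntegrandDeriv α s t ≤ cIntegrand α (s + h) t - cIntegrand α s t := by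
  have h1 := mul_rpow_mul_log_le (abs_one_sub_pos ht1) s h
  have h2 := mul_rpow_mul_log_le (by linarith : 0 < 1 + t) s h
  rw [cIntegrandDeriv, cIntegrand, cIntegrand, ← sub_div, ← mul_div_assoc]
  refine div_le_div_of_nonneg_right ?_ (rpow_nonneg ht.le _)
  linarith

lemma sq_mul_cIntegrandDerivTwo_le (ht : 0 < t) (ht1 : t ≠ 1) (s h : ℝ) :
    h ^ 2 * cIntegrandDerivTwo α s t ≤
      cIntegrand α (s + h) t + cIntegrand α (s - h) t - 2 * cIntegrand α s t := by
  have h1 := sq_mul_rpow_mul_log_sq_le (abs_one_sub_pos ht1) s h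
  have h2 := sq_mul_rpow_mul_log_sq_le (by linarith : 0 < 1 + t) s h
  simp only [cIntegrandDerivTwo, cIntegrand]
  rw [← add_div, ← mul_div_assoc, ← mul_div_assoc, ← sub_div]
  refine div_le_div_of_nonneg_right ?_ (rpow_nonneg ht.le _)
  linarith

lemma cIntegrandDerivTwo_pos (ht : 0 < t) (s : ℝ) : 0 < cIntegrandDerivTwo α s t := by
  have h1 : 0 ≤ |1 - t| ^ s := rpow_nonneg (abs_nonneg _) _
  have h2 : 0 < log (1 + t) := log_pos (by linarith)
  rw [cIntegrandDerivTwo]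
  positivity

lemma monotone_cIntegrandDeriv (ht : 0 < t) (ht1 : t ≠ 1) :
    Monotone fun s => cIntegrandDeriv α s t := by
  intro a b hab
  exact div_le_div_of_nonneg_right
    (add_le_add (monotone_rpow_mul_log (abs_one_sub_pos ht1) hab)
      (monotone_rpow_mul_log (by linarith : 0 < 1 + t) hab)) (rpow_nonneg ht.le _)

lemma cIntegrandDerivTwo_le_add (ht : 0 < t) (ht1 : t ≠ 1) {a s b : ℝ} (has : a ≤ s)
    (hsb : s ≤ b) :
    cIntegrandDerivTwo α s t ≤ cIntegrandDerivTwo α a t + cIntegrandDerivTwo α b t := by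
  have h1 := mul_le_mul_of_nonneg_right
    (rpow_le_rpow_add_rpow (abs_one_sub_pos ht1) has hsb) (sq_nonneg (log |1 - t|))
  have h2 := mul_le_mul_of_nonneg_right
    (rpow_le_rpow_add_rpow (by linarith : 0 < 1 + t) has hsb) (sq_nonneg (log (1 + t)))
  simp only [cIntegrandDerivTwo]
  rw [← add_div]
  refine div_le_div_of_nonneg_right ?_ (rpow_nonneg ht.le _)
  linarith

lemma hasDerivAt_cIntegrand (ht : 0 < t) (ht1 : t ≠ 1) (s : ℝ) :
    HasDerivAt (fun r => cIntegrand α r t) (cIntegrandDeriv α s t) s :=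
  (((hasStrictDerivAt_const_rpow (abs_one_sub_pos ht1) s).hasDerivAt.add
    (hasStrictDerivAt_const_rpow (by linarith : 0 < 1 + t) s).hasDerivAt).sub_const 2).div_const _

lemma hasDerivAt_cIntegrandDeriv (ht : 0 < t) (ht1 : t ≠ 1) (s : ℝ) :
    HasDerivAt (fun r => cIntegrandDeriv α r t) (cIntegrandDerivTwo α s t) s := by
  have h1 := (hasStrictDerivAt_const_rpow (abs_one_sub_pos ht1) s).hasDerivAt.mul_const
    (log |1 - t|)
  have h2 := (hasStrictDerivAt_const_rpow (by linarith : 0 < 1 + t) s).hasDerivAt.mul_const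
    (log (1 + t))
  rw [mul_assoc, ← sq] at h1 h2
  exact (h1.add h2).div_const _

lemma strictConvexOn_cIntegrand (ht : 0 < t) (ht1 : t ≠ 1) :
    StrictConvexOn ℝ univ fun s => cIntegrand α s t := by
  have h := (convexOn_const_rpow (abs_one_sub_pos ht1)).add_strictConvexOn
    (strictConvexOn_const_rpow (by linarith : 0 < 1 + t) (by linarith))
  refine ⟨convex_univ, fun s _ r _ hsr a b ha hb hab => ?_⟩
  have := h.2 (mem_univ s) (mem_univ r) hsr ha hb hab
  simp only [cIntegrand, smul_eq_mul, Pi.add_apply] at this ⊢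
  rw [← mul_div_assoc, ← mul_div_assoc, ← add_div]
  refine div_lt_div_of_pos_right ?_ (rpow_pos_of_pos ht _)
  linear_combination this + 2 * hab

end Pointwise

lemma exists_pos_add_sub_mem_Ioo {s a b : ℝ} (hs : s ∈ Ioo a b) :
    ∃ h > 0, s + h ∈ Ioo a b ∧ s - h ∈ Ioo a b := by
  obtain ⟨h1, h2⟩ := hs
  refine ⟨min (s - a) (b - s) / 2, half_pos (lt_min (by linarith) (by linarith)), ?_⟩
  have h3 := min_le_left (s - a) (b - s)
  have h4 := min_le_right (s - a) (b - s)
  have h5 : 0 < min (s - a) (b - s) := lt_min (by linarith) (by linarith)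
  refine ⟨⟨?_, ?_⟩, ?_, ?_⟩ <;> linarith

lemma integrableOn_cIntegrandDeriv {α s : ℝ} (hα : α ∈ Ioo (0 : ℝ) 1)
    (hs : s ∈ Ioo (-1 : ℝ) 0) : IntegrableOn (cIntegrandDeriv α s) (Ioi 0) := by
  obtain ⟨h, hh, hp, hm⟩ := exists_pos_add_sub_mem_Ioo hs
  have i0 := integrableOn_cIntegrand hα (Ioo_subset_Ioc_self hs)
  have i1 := integrableOn_cIntegrand hα (Ioo_subset_Ioc_self hp)
  have i2 := integrableOn_cIntegrand hα (Ioo_subset_Ioc_self hm)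
  refine Integrable.mono' (((i1.sub i0).abs.add (i2.sub i0).abs).div_const h)
    (measurable_cIntegrandDeriv α s).aestronglyMeasurable ?_
  filter_upwards [ae_restrict_Ioi_pos_and_ne_one] with t ⟨ht, ht1⟩
  have h1 := mul_cIntegrandDeriv_le α ht ht1 s h
  have h2 := mul_cIntegrandDeriv_le α ht ht1 s (-h)
  rw [← sub_eq_add_neg] at h2
  rw [norm_eq_abs, le_div_iff₀ hh, ← abs_of_pos hh, ← abs_mul, abs_of_pos hh]
  simp only [Pi.add_apply, Pi.sub_apply]
  have h3 := le_abs_self (cIntegrand α (s + h) t - cIntegrand α s t)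
  have h4 := le_abs_self (cIntegrand α (s - h) t - cIntegrand α s t)
  have h5 := abs_nonneg (cIntegrand α (s + h) t - cIntegrand α s t)
  have h6 := abs_nonneg (cIntegrand α (s - h) t - cIntegrand α s t)
  rw [abs_le]
  constructor <;> linarith

lemma integrableOn_cIntegrandDerivTwo {α s : ℝ} (hα : α ∈ Ioo (0 : ℝ) 1)
    (hs : s ∈ Ioo (-1 : ℝ) 0) : IntegrableOn (cIntegrandDerivTwo α s) (Ioi 0) := by
  obtain ⟨h, hh, hp, hm⟩ := exists_pos_add_sub_mem_Ioo hs
  have i0 := integrableOn_cIntegrand hα (Ioo_subset_Ioc_self hs)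
  have i1 := integrableOn_cIntegrand hα (Ioo_subset_Ioc_self hp)
  have i2 := integrableOn_cIntegrand hα (Ioo_subset_Ioc_self hm)
  refine Integrable.mono' (((i1.add i2).sub (i0.const_mul 2)).div_const (h ^ 2))
    (measurable_cIntegrandDerivTwo α s).aestronglyMeasurable ?_
  filter_upwards [ae_restrict_Ioi_pos_and_ne_one] with t ⟨ht, ht1⟩
  rw [norm_of_nonneg (cIntegrandDerivTwo_pos α ht s).le, le_div_iff₀ (by positivity), mul_comm]
  exact sq_mul_cIntegrandDerivTwo_le α ht ht1 s h

lemma hasDerivAt_c_s2 {α s : ℝ} (hα : α ∈ Ioo (0 : ℝ) 1) (hs : s ∈ Ioo (-1 : ℝ) 0) :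
    HasDerivAt (c α) (∫ t in Ioi (0 : ℝ), cIntegrandDeriv α s t) s := by
  obtain ⟨h, hh, hp, hm⟩ := exists_pos_add_sub_mem_Ioo hs
  refine (hasDerivAt_integral_of_dominated_loc_of_deriv_le (F := cIntegrand α)
    (F' := cIntegrandDeriv α)
    (bound := fun t => |cIntegrandDeriv α (s - h) t| + |cIntegrandDeriv α (s + h) t|)
    (Icc_mem_nhds (by linarith : s - h < s) (by linarith : s < s + h))
    (.of_forall fun r => (measurable_cIntegrand α r).aestronglyMeasurable)
    (integrableOn_cIntegrand hα (Ioo_subset_Ioc_self hs))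
    (measurable_cIntegrandDeriv α s).aestronglyMeasurable ?_
    ((integrableOn_cIntegrandDeriv hα hm).abs.add (integrableOn_cIntegrandDeriv hα hp).abs)
    ?_).2
  · filter_upwards [ae_restrict_Ioi_pos_and_ne_one] with t ⟨ht, ht1⟩ r hr
    have h1 := monotone_cIntegrandDeriv α ht ht1 hr.1
    have h2 := monotone_cIntegrandDeriv α ht ht1 hr.2
    rw [norm_eq_abs]
    exact (abs_le_max_abs_abs h1 h2).trans (max_le_add_of_nonneg (abs_nonneg _) (abs_nonneg _))
  · filter_upwards [ae_restrict_Ioi_pos_and_ne_one] with t ⟨ht, ht1⟩ r _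
    exact hasDerivAt_cIntegrand α ht ht1 r

lemma hasDerivAt_integral_cIntegrandDeriv {α s : ℝ} (hα : α ∈ Ioo (0 : ℝ) 1)
    (hs : s ∈ Ioo (-1 : ℝ) 0) :
    HasDerivAt (fun r => ∫ t in Ioi (0 : ℝ), cIntegrandDeriv α r t)
      (∫ t in Ioi (0 : ℝ), cIntegrandDerivTwo α s t) s := by
  obtain ⟨h, hh, hp, hm⟩ := exists_pos_add_sub_mem_Ioo hs
  refine (hasDerivAt_integral_of_dominated_loc_of_deriv_le (F := cIntegrandDeriv α)
    (F' := cIntegrandDerivTwo α)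
    (bound := fun t => cIntegrandDerivTwo α (s - h) t + cIntegrandDerivTwo α (s + h) t)
    (Icc_mem_nhds (by linarith : s - h < s) (by linarith : s < s + h))
    (.of_forall fun r => (measurable_cIntegrandDeriv α r).aestronglyMeasurable)
    (integrableOn_cIntegrandDeriv hα hs)
    (measurable_cIntegrandDerivTwo α s).aestronglyMeasurable ?_
    ((integrableOn_cIntegrandDerivTwo hα hm).add (integrableOn_cIntegrandDerivTwo hα hp))
    ?_).2
  · filter_upwards [ae_restrict_Ioi_pos_and_ne_one] with t ⟨ht, ht1⟩ r hr
    rw [norm_of_nonneg (cIntegrandDerivTwo_pos α ht r).le]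
    exact cIntegrandDerivTwo_le_add α ht ht1 hr.1 hr.2
  · filter_upwards [ae_restrict_Ioi_pos_and_ne_one] with t ⟨ht, ht1⟩ r _
    exact hasDerivAt_cIntegrandDeriv α ht ht1 r

lemma strictConvexOn_c {α : ℝ} (hα : α ∈ Ioo (0 : ℝ) 1) :
    StrictConvexOn ℝ (Ioc (-1 : ℝ) 0) (c α) := by
  refine ⟨convex_Ioc _ _, fun s hs r hr hsr a b ha hb hab => ?_⟩
  have is := integrableOn_cIntegrand hα hs
  have ir := integrableOn_cIntegrand hα hr
  have im := integrableOn_cIntegrand hα (convex_Ioc (-1 : ℝ) 0 hs hr ha.le hb.le hab)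
  have hpos := setIntegral_Ioi_pos (((is.const_mul a).add (ir.const_mul b)).sub im)
    fun t ht ht1 => sub_pos.2
      ((strictConvexOn_cIntegrand α ht ht1).2 (mem_univ s) (mem_univ r) hsr ha hb hab)
  rw [integral_sub' ((is.const_mul a).add (ir.const_mul b)) im,
    integral_add' (is.const_mul a) (ir.const_mul b), integral_const_mul,
    integral_const_mul] at hpos
  exact sub_pos.1 hpos

theorem second_deriv_c (α : ℝ) (hα : α ∈ Set.Ioo (0:ℝ) 1) :
    (∀ τ ∈ Set.Ioo (-1:ℝ) 0,
      HasDerivAt (deriv (fun s => c α s))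
        (∫ t in Set.Ioi (0:ℝ),
          (|1 - t| ^ τ * (Real.log |1 - t|) ^ 2 + (1 + t) ^ τ * (Real.log (1 + t)) ^ 2)
            / t ^ (1 + 2 * α)) τ ∧
      0 < ∫ t in Set.Ioi (0:ℝ),
          (|1 - t| ^ τ * (Real.log |1 - t|) ^ 2 + (1 + t) ^ τ * (Real.log (1 + t)) ^ 2)
            / t ^ (1 + 2 * α)) ∧
    StrictConvexOn ℝ (Set.Ioc (-1:ℝ) 0) (fun τ => c α τ) := by
  refine ⟨fun τ hτ => ⟨?_, ?_⟩, strictConvexOn_c hα⟩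
  · refine (hasDerivAt_integral_cIntegrandDeriv hα hτ).congr_of_eventuallyEq ?_
    filter_upwards [isOpen_Ioo.mem_nhds hτ] with s hs
    exact (hasDerivAt_c_s2 hα hs).deriv
  · exact setIntegral_Ioi_pos (integrableOn_cIntegrandDerivTwo hα hτ)
      fun t ht _ => cIntegrandDerivTwo_pos α ht τ
end
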